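/- Let m, n ≥ 1 and let f₁, f₂ ∈ ℂ[w₁,w₂,w₃] be squarefree homogeneous polynomials of degrees m, n with f₁(0,0,1) ≠ 0 and f₂(0,0,1) ≠ 0, and let Γ = {[v] ∈ ℙ³ : f₁(v₁,v₂,v₃) = 0 and f₂(v₁,v₂,v₄) = 0}. Then there exists a nonzero homogeneous polynomial f_∞ ∈ ℂ[z₁,z₂,z₃,z₄] of degree m+n such that: (i) the projection π₀ : [v] ↦ [v₁:v₂] is injective on Γ ∩ {f_∞ = 0}; and (ii) no point of Γ ∩ {f_∞ = 0} lies in a fiber of π₀|Γ containing fewer than mn points. -/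

import Mathlib

open MvPolynomial

/-- The fiber over `[x₁:x₂] ∈ ℙ¹` of the projection `π₀ : [v] ↦ [v₁:v₂]` restricted to
the double curve `Γ = {[v] ∈ ℙ³ : f₁(v₁,v₂,v₃) = 0 ∧ f₂(v₁,v₂,v₄) = 0}`. -/
def gammaFiber (f₁ f₂ : MvPolynomial (Fin 3) ℂ) (x₁ x₂ : ℂ) :
    Set (Projectivization ℂ (Fin 4 → ℂ)) :=
  {y | ∃ v : Fin 4 → ℂ, ∃ hv : v ≠ 0, y = Projectivization.mk ℂ v hv ∧
    eval ![v 0, v 1, v 2] f₁ = 0 ∧ eval ![v 0, v 1, v 3] f₂ = 0 ∧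
    ∃ c : ℂ, c ≠ 0 ∧ v 0 = c * x₁ ∧ v 1 = c * x₂}

/-- The resultant of `P` and its derivative, computed in formal degrees `N` and `N - 1`, detects
separability of every specialization of `P` of degree `N`. -/
lemma map_resultant_derivative_ne_zero_iff {A K : Type*} [CommRing A] [Field K] [CharZero K]
    (φ : A →+* K) (P : Polynomial A) {N : ℕ} (hN : (P.map φ).natDegree = N)
    (hP : P.map φ ≠ 0) :
    φ (P.resultant (Polynomial.derivative P) N (N - 1)) ≠ 0 ↔ (P.map φ).Separable := by
  have h : φ (P.resultant (Polynomial.derivative P) N (N - 1)) =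
      (P.map φ).resultant (Polynomial.derivative (P.map φ)) := by
    rw [← Polynomial.resultant_map_map, Polynomial.natDegree_derivative, Polynomial.derivative_map,
      hN]
  rw [h, ne_eq, Polynomial.resultant_eq_zero_iff, Polynomial.Separable]
  simp [hP]

lemma squarefree_map_fractionRing {R K : Type*} [CommRing R] [IsDomain R] [IsIntegrallyClosed R]
    [Field K] [Algebra R K] [IsFractionRing R K] {F : Polynomial R} (hF : F.Monic)
    (hsq : Squarefree F) : Squarefree (F.map (algebraMap R K)) := by
  intro g hg
  obtain ⟨g', hg'⟩ := IsIntegrallyClosed.eq_map_mul_C_of_dvd K hF (dvd_of_mul_left_dvd hg)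
  have hinj := IsFractionRing.injective R K
  have hg0 : g ≠ 0 := by
    rintro rfl
    exact (hF.map (algebraMap R K)).ne_zero (by simpa using hg)
  have hlc : g.leadingCoeff ≠ 0 := Polynomial.leadingCoeff_ne_zero.mpr hg0
  have hCu : IsUnit (Polynomial.C g.leadingCoeff) :=
    Polynomial.isUnit_C.mpr hlc.isUnit
  have hassoc : Associated (g'.map (algebraMap R K)) g := ⟨hCu.unit, by simpa using hg'⟩
  have hmonic : (g'.map (algebraMap R K)).Monic := by
    have h := congrArg Polynomial.leadingCoeff hg'
    rw [Polynomial.leadingCoeff_mul, Polynomial.leadingCoeff_C] at h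
    exact mul_right_cancel₀ hlc (by rw [h, one_mul])
  have hg'm : g'.Monic := Polynomial.monic_of_injective hinj hmonic
  have hdvd : (g' * g').map (algebraMap R K) ∣ F.map (algebraMap R K) := by
    rw [Polynomial.map_mul]
    exact (hassoc.mul_mul hassoc).dvd.trans hg
  have hu := hsq g' (hF.dvd_of_fraction_map_dvd_fraction_map (hg'm.mul hg'm) hdvd)
  exact hassoc.isUnit (hu.map (Polynomial.mapRingHom (algebraMap R K)))

/-- A monic squarefree polynomial over an integrally closed domain of characteristic zero stays
separable away from the zeros of a nonzero element of the base. -/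
lemma exists_ne_zero_forall_separable_map {R : Type*} [CommRing R] [IsDomain R]
    [IsIntegrallyClosed R] [CharZero R] {F : Polynomial R} (hF : F.Monic) (hsq : Squarefree F) :
    ∃ d : R, d ≠ 0 ∧ ∀ {L : Type} [Field L] [CharZero L] (φ : R →+* L),
      φ d ≠ 0 → (F.map φ).Separable := by
  let K := FractionRing R
  have : CharZero K := charZero_of_injective_algebraMap (IsFractionRing.injective R K)
  refine ⟨F.resultant (Polynomial.derivative F) F.natDegree (F.natDegree - 1), ?_, ?_⟩
  · have h := (map_resultant_derivative_ne_zero_iff (algebraMap R K) F (hF.natDegree_map _)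
      (hF.map _).ne_zero).mpr
      (PerfectField.separable_iff_squarefree.mpr (squarefree_map_fractionRing hF hsq))
    exact fun h0 ↦ h (by rw [h0, map_zero])
  · intro L _ _ φ h
    exact (map_resultant_derivative_ne_zero_iff φ F (hF.natDegree_map _)
      (hF.map _).ne_zero).mp h

/-- A squarefree homogeneous form not vanishing at `(0,0,1)` is, up to a scalar, a monic squarefree
polynomial in the last variable. -/
lemma exists_monic_of_isHomogeneous {m : ℕ} {f : MvPolynomial (Fin 3) ℂ}
    (hsf : Squarefree f) (hom : f.IsHomogeneous m) (hv : eval ![0, 0, 1] f ≠ 0) :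
    ∃ F : Polynomial (MvPolynomial (Fin 2) ℂ), F.Monic ∧ F.natDegree = m ∧ Squarefree F ∧
      ∀ (x : Fin 2 → ℂ) (z : ℂ),
        (F.map (eval x)).eval z = 0 ↔ eval ![x 0, x 1, z] f = 0 := by
  let e := (renameEquiv ℂ (finRotate 3)).trans (finSuccEquiv ℂ 2)
  have he : ∀ (x : Fin 2 → ℂ) (z : ℂ), ((e f).map (eval x)).eval z = eval ![x 0, x 1, z] f := by
    intro x z
    have h := eval_polynomial_eval_finSuccEquiv (x := x) (rename (finRotate 3) f) (C z)
    rw [eval_rename] at h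
    have h2 : (Fin.cases (eval x (C z)) x : Fin 3 → ℂ) ∘ finRotate 3 = ![x 0, x 1, z] := by
      funext i
      fin_cases i <;> simp [finRotate_apply] <;> rfl
    rw [h2, ← Polynomial.eval₂_at_apply, eval_C, ← Polynomial.eval_map] at h
    exact h
  have hdeg : (e f).natDegree ≤ m := by
    change (finSuccEquiv ℂ 2 (rename (finRotate 3) f)).natDegree ≤ m
    rw [natDegree_finSuccEquiv]
    exact (degreeOf_le_totalDegree _ _).trans (hom.rename_isHomogeneous.totalDegree_le)
  have hcoeff : ∀ i j, i + j = m → ((e f).coeff i).IsHomogeneous j := fun i j h ↦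
    (hom.rename_isHomogeneous (f := finRotate 3)).finSuccEquiv_coeff_isHomogeneous i j h
  obtain ⟨c, hc⟩ : ∃ c, (e f).coeff m = C c := by
    have h := hcoeff m 0 (by simp)
    exact ⟨_, totalDegree_eq_zero_iff_eq_C.mp (Nat.le_zero.mp h.totalDegree_le)⟩
  have hc0 : c ≠ 0 := by
    have h := he 0 1
    rw [Polynomial.eval_eq_sum_range' (n := m + 1)
      (Nat.lt_succ_of_le (Polynomial.natDegree_map_le.trans hdeg)),
      Finset.sum_range_succ, Finset.sum_eq_zero] at h
    · rintro rfl
      simp only [Polynomial.coeff_map, hc] at h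
      apply hv
      simpa using h.symm
    · intro i hi
      rw [Finset.mem_range] at hi
      have h0 : eval (0 : Fin 2 → ℂ) ((e f).coeff i) = 0 := by
        rw [eval_zero]
        exact (hcoeff i (m - i) (by lia)).coeff_eq_zero (by simp; lia)
      rw [Polynomial.coeff_map, h0, zero_mul]
  have hdeg' : (e f).natDegree = m := by
    refine le_antisymm hdeg (Polynomial.le_natDegree_of_ne_zero ?_)
    rw [hc]
    exact C_ne_zero.mpr hc0
  have hCunit : IsUnit (Polynomial.C (C c⁻¹ : MvPolynomial (Fin 2) ℂ)) :=
    Polynomial.isUnit_C.mpr ((inv_ne_zero hc0).isUnit.map C)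
  have hC0 : (C c⁻¹ : MvPolynomial (Fin 2) ℂ) ≠ 0 := C_ne_zero.mpr (inv_ne_zero hc0)
  refine ⟨Polynomial.C (C c⁻¹) * e f, ?_, ?_, ?_, ?_⟩
  · rw [Polynomial.Monic, Polynomial.leadingCoeff_mul, Polynomial.leadingCoeff_C,
      Polynomial.leadingCoeff, hdeg', hc, ← C_mul, inv_mul_cancel₀ hc0, C_1]
  · rw [Polynomial.natDegree_C_mul hC0, hdeg']
  · have hassoc : Associated (e f) (Polynomial.C (C c⁻¹) * e f) :=
      ⟨hCunit.unit, by simp [mul_comm]⟩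
    refine hassoc.squarefree_iff.mp fun g hg ↦ ?_
    have h : e.symm g * e.symm g ∣ f := by
      simpa using map_dvd e.symm hg
    simpa using (hsf _ h).map e
  · intro x z
    rw [Polynomial.map_mul, Polynomial.eval_mul, he]
    simp [hc0]

/-- The polynomial in `t` whose roots are `b - lam * a` for `a`, `b` roots of `F`, `G`, as the
resultant in `z` of `F(z)` and `G(t + lam * z)`. -/
noncomputable def rootCombination {A : Type*} [CommRing A] (F G : Polynomial A) (m n : ℕ)
    (lam : A) : Polynomial A :=
  (F.map Polynomial.C).resultant
    (G.eval₂ (Polynomial.C.comp Polynomial.C)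
      (Polynomial.C Polynomial.X + Polynomial.C (Polynomial.C lam) * Polynomial.X)) m n

lemma map_rootCombination {A K : Type*} [CommRing A] [CommRing K] (φ : A →+* K)
    (F G : Polynomial A) (m n : ℕ) (lam : A) :
    (rootCombination F G m n lam).map φ =
      rootCombination (F.map φ) (G.map φ) m n (φ lam) := by
  unfold rootCombination
  rw [← Polynomial.coe_mapRingHom, ← Polynomial.resultant_map_map]
  congr 1
  · rw [Polynomial.map_map, Polynomial.coe_mapRingHom, Polynomial.map_map]
    congr 1
    ext
    simp
  · rw [← Polynomial.coe_mapRingHom, Polynomial.hom_eval₂, Polynomial.coe_mapRingHom φ,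
      Polynomial.eval₂_map]
    congr 1
    · ext
      simp
    · simp

lemma rootCombination_eq_prod {K : Type*} [Field K] [IsAlgClosed K] {F G : Polynomial K}
    (hF : F.Monic) (hG : G.Monic) (lam : K) :
    rootCombination F G F.natDegree G.natDegree lam =
      (((F.roots ×ˢ G.roots).map fun p ↦ p.2 - lam * p.1).map
        fun r ↦ Polynomial.X - Polynomial.C r).prod := by
  have hFs : F.Splits := IsAlgClosed.splits F
  have hdegF : F.natDegree = (F.map Polynomial.C).natDegree := (hF.natDegree_map _).symm
  have hGs : G = (G.roots.map fun b ↦ Polynomial.X - Polynomial.C b).prod :=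
    (IsAlgClosed.splits G).eq_prod_roots_of_monic hG
  unfold rootCombination
  rw [hdegF, Polynomial.resultant_eq_prod_eval _ _ _ ?_ (hFs.map _), (hF.map _).leadingCoeff,
    one_pow, one_mul, hFs.roots_map, Multiset.map_map, Multiset.map_map, SProd.sprod,
    Multiset.instSProd]
  · simp only [Multiset.product, Multiset.map_bind, Multiset.prod_bind, Multiset.map_map]
    congr 1
    refine Multiset.map_congr rfl fun a _ ↦ ?_
    simp only [Function.comp_apply]
    rw [← Polynomial.coe_evalRingHom, Polynomial.hom_eval₂]
    conv_lhs => rw [hGs]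
    rw [← Polynomial.coe_eval₂RingHom, map_multiset_prod, Multiset.map_map]
    congr 1
    refine Multiset.map_congr rfl fun b _ ↦ ?_
    simp
    ring
  · rw [Polynomial.eval₂_eq_sum_range]
    refine Polynomial.natDegree_sum_le_of_forall_le _ _ fun i hi ↦ ?_
    rw [Finset.mem_range, Nat.lt_succ_iff] at hi
    refine le_trans ?_ hi
    rw [RingHom.comp_apply]
    refine (Polynomial.natDegree_C_mul_le _ _).trans ?_
    refine Polynomial.natDegree_pow_le.trans ?_
    nth_rewrite 2 [← mul_one i]
    exact Nat.mul_le_mul_left i (by compute_degree)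

/-- The locus where the values `b - lam * a`, for `a` and `b` roots of monic `F` and `G`, are
pairwise distinct is the nonvanishing locus of an element of the base. -/
lemma exists_forall_nodup_iff {A : Type*} [CommRing A] {F G : Polynomial A} (hF : F.Monic)
    (hG : G.Monic) (lam : A) :
    ∃ d : A, ∀ φ : A →+* ℂ, φ d ≠ 0 ↔
      (((F.map φ).roots ×ˢ (G.map φ).roots).map fun p ↦ p.2 - φ lam * p.1).Nodup := by
  let P := rootCombination F G F.natDegree G.natDegree lam
  let N := F.natDegree * G.natDegree
  refine ⟨P.resultant (Polynomial.derivative P) N (N - 1), fun φ ↦ ?_⟩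
  have hP := map_rootCombination φ F G F.natDegree G.natDegree lam
  rw [← hF.natDegree_map φ, ← hG.natDegree_map φ,
    rootCombination_eq_prod (hF.map φ) (hG.map φ)] at hP
  rw [hF.natDegree_map, hG.natDegree_map] at hP
  set s := ((F.map φ).roots ×ˢ (G.map φ).roots).map fun p ↦ p.2 - φ lam * p.1 with hs
  have hmonic : (P.map φ).Monic := by
    rw [show P.map φ = _ from hP]
    exact Polynomial.monic_multiset_prod_of_monic _ _ fun r _ ↦ Polynomial.monic_X_sub_C r
  have hdeg : (P.map φ).natDegree = N := by
    rw [show P.map φ = _ from hP, Polynomial.natDegree_multiset_prod_X_sub_C_eq_card, hs,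
      Multiset.card_map, Multiset.card_product,
      ← (IsAlgClosed.splits (F.map φ)).natDegree_eq_card_roots,
      ← (IsAlgClosed.splits (G.map φ)).natDegree_eq_card_roots,
      hF.natDegree_map, hG.natDegree_map]
  rw [map_resultant_derivative_ne_zero_iff φ P hdeg hmonic.ne_zero,
    ← Polynomial.nodup_roots_iff_of_splits hmonic.ne_zero (IsAlgClosed.splits _),
    show P.map φ = _ from hP, Polynomial.roots_multiset_prod_X_sub_C]

lemma eval_eq_zero_iff_of_eq_smul {σ : Type*} {d : ℕ} {f : MvPolynomial σ ℂ}
    (hom : f.IsHomogeneous d) {c : ℂ} (hc : c ≠ 0) {u v : σ → ℂ} (h : v = c • u) :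
    eval v f = 0 ↔ eval u f = 0 := by
  have : eval v f = c ^ d * eval u f := by
    rw [h, eval_eq, eval_eq, Finset.mul_sum]
    refine Finset.sum_congr rfl fun e he ↦ ?_
    have hd : ∑ i ∈ e.support, e i = d := by
      have := hom.degree_eq_sum_deg_support he
      exact this.symm
    simp only [Pi.smul_apply, smul_eq_mul, mul_pow, Finset.prod_mul_distrib,
      Finset.prod_pow_eq_pow_sum, hd]
    ring
  rw [this, mul_eq_zero, or_iff_right (pow_ne_zero _ hc)]

/-- If all roots of the two specialized equations over `x` are simple, then the fiber over `[x]`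
has `mn` points. -/
lemma ncard_gammaFiber {m n : ℕ} {f₁ f₂ : MvPolynomial (Fin 3) ℂ}
    (hf₁hom : f₁.IsHomogeneous m) (hf₂hom : f₂.IsHomogeneous n) {F G : Polynomial ℂ}
    (hF : F.Monic) (hG : G.Monic) (hFm : F.natDegree = m) (hGn : G.natDegree = n)
    {x₁ x₂ : ℂ} (hx : x₁ ≠ 0)
    (hFf : ∀ z, F.eval z = 0 ↔ eval ![x₁, x₂, z] f₁ = 0)
    (hGf : ∀ z, G.eval z = 0 ↔ eval ![x₁, x₂, z] f₂ = 0)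
    (hnd : (F.roots ×ˢ G.roots).Nodup) {k : ℂ} (hk : k ≠ 0) :
    (gammaFiber f₁ f₂ (k * x₁) (k * x₂)).ncard = m * n := by
  let T : Finset (ℂ × ℂ) := ⟨F.roots ×ˢ G.roots, hnd⟩
  have hT : ∀ p, p ∈ T ↔ eval ![x₁, x₂, p.1] f₁ = 0 ∧ eval ![x₁, x₂, p.2] f₂ = 0 := by
    intro p
    rw [← hFf, ← hGf]
    change p ∈ F.roots ×ˢ G.roots ↔ _
    rw [Multiset.mem_product, Polynomial.mem_roots hF.ne_zero, Polynomial.mem_roots hG.ne_zero]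
    rfl
  have hne : ∀ p : ℂ × ℂ, (![x₁, x₂, p.1, p.2] : Fin 4 → ℂ) ≠ 0 := fun p h ↦
    hx (congrFun h 0)
  let ι : ℂ × ℂ → Projectivization ℂ (Fin 4 → ℂ) := fun p ↦ Projectivization.mk ℂ _ (hne p)
  have hι : Function.Injective ι := by
    intro p q hpq
    obtain ⟨a, ha⟩ := (Projectivization.mk_eq_mk_iff' ℂ _ _ _ _).mp hpq
    have h0 : a * x₁ = x₁ := congrFun ha 0
    have h2 : a * q.1 = p.1 := congrFun ha 2
    have h3 : a * q.2 = p.2 := congrFun ha 3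
    have ha1 : a = 1 := mul_right_cancel₀ hx (by rw [h0, one_mul])
    rw [ha1, one_mul] at h2 h3
    exact Prod.ext h2.symm h3.symm
  have himage : gammaFiber f₁ f₂ (k * x₁) (k * x₂) = ι '' (T : Set (ℂ × ℂ)) := by
    ext y
    constructor
    · rintro ⟨v, hv, rfl, h1, h2, c, hc, hv0, hv1⟩
      have hck : c * k ≠ 0 := mul_ne_zero hc hk
      have e0 : v 0 = (c * k) * x₁ := by rw [hv0, mul_assoc]
      have e1 : v 1 = (c * k) * x₂ := by rw [hv1, mul_assoc]
      have e2 : ∀ i, v i = (c * k) * ((c * k)⁻¹ * v i) := fun i ↦ by field_simp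
      refine ⟨((c * k)⁻¹ * v 2, (c * k)⁻¹ * v 3), ?_, ?_⟩
      · rw [Finset.mem_coe, hT]
        refine ⟨(eval_eq_zero_iff_of_eq_smul hf₁hom hck ?_).mp h1,
          (eval_eq_zero_iff_of_eq_smul hf₂hom hck ?_).mp h2⟩ <;>
        · funext i
          fin_cases i
          exacts [e0, e1, e2 _]
      · refine (Projectivization.mk_eq_mk_iff' ℂ _ _ _ _).mpr ⟨(c * k)⁻¹, ?_⟩
        funext i
        fin_cases i
        · change (c * k)⁻¹ * v 0 = x₁
          rw [e0, inv_mul_cancel_left₀ hck]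
        · change (c * k)⁻¹ * v 1 = x₂
          rw [e1, inv_mul_cancel_left₀ hck]
        · rfl
        · rfl
    · rintro ⟨p, hp, rfl⟩
      obtain ⟨h1, h2⟩ := (hT p).mp hp
      exact ⟨_, hne p, rfl, h1, h2, k⁻¹, inv_ne_zero hk,
        (inv_mul_cancel_left₀ hk x₁).symm, (inv_mul_cancel_left₀ hk x₂).symm⟩
  rw [himage, Set.ncard_image_of_injective _ hι, Set.ncard_coe_finset]
  change Multiset.card (F.roots ×ˢ G.roots) = _
  rw [Multiset.card_product, ← (IsAlgClosed.splits F).natDegree_eq_card_roots,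
    ← (IsAlgClosed.splits G).natDegree_eq_card_roots, hFm, hGn]

/-- For two finite sets of complex numbers, a general linear combination separates the points of
their product. -/
lemma exists_injOn_sub_mul (s t : Finset ℂ) :
    ∃ lam : ℂ, Set.InjOn (fun p : ℂ × ℂ ↦ p.2 - lam * p.1) (s ×ˢ t : Finset (ℂ × ℂ)) := by
  obtain ⟨lam, -, hlam⟩ := (Set.infinite_univ (α := ℂ)).exists_notMem_finite
    (Finset.finite_toSet (((s ×ˢ t) ×ˢ (s ×ˢ t)).image
      fun r : (ℂ × ℂ) × (ℂ × ℂ) ↦ (r.1.2 - r.2.2) / (r.1.1 - r.2.1)))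
  refine ⟨lam, fun p hp q hq hpq ↦ ?_⟩
  simp only at hpq
  by_cases h : p.1 = q.1
  · rw [h] at hpq
    exact Prod.ext h (sub_left_injective hpq)
  · refine absurd ?_ hlam
    rw [Finset.mem_coe, Finset.mem_image]
    refine ⟨(p, q), Finset.mem_product.mpr ⟨hp, hq⟩, ?_⟩
    have h' : p.1 - q.1 ≠ 0 := sub_ne_zero.mpr h
    rw [div_eq_iff h']
    linear_combination hpq

/-- The set of values `b - lam * a` for `a` a root of `F` and `b` a root of `G` over `x`. -/
noncomputable def rootCombinationValues (F G : Polynomial (MvPolynomial (Fin 2) ℂ)) (lam : ℂ)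
    (x : Fin 2 → ℂ) : Multiset ℂ :=
  ((F.map (eval x)).roots ×ˢ (G.map (eval x)).roots).map fun p ↦ p.2 - lam * p.1

lemma mem_rootCombinationValues {F G : Polynomial (MvPolynomial (Fin 2) ℂ)} (hF : F.Monic)
    (hG : G.Monic) (lam : ℂ) (x : Fin 2 → ℂ) {a b : ℂ} (ha : (F.map (eval x)).eval a = 0)
    (hb : (G.map (eval x)).eval b = 0) : b - lam * a ∈ rootCombinationValues F G lam x :=
  Multiset.mem_map.mpr ⟨(a, b), Multiset.mem_product.mpr
    ⟨(Polynomial.mem_roots (hF.map _).ne_zero).mpr ha,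
      (Polynomial.mem_roots (hG.map _).ne_zero).mpr hb⟩, rfl⟩

/-- For a suitable `lam`, the values `b - lam * a` are pairwise distinct away from finitely many
points of an affine chart of the line. -/
lemma exists_finite_setOf_not_nodup {F G : Polynomial (MvPolynomial (Fin 2) ℂ)} (hF : F.Monic)
    (hG : G.Monic) (hFsq : Squarefree F) (hGsq : Squarefree G) :
    ∃ lam x₁ : ℂ, x₁ ≠ 0 ∧
      {s : ℂ | ¬ (rootCombinationValues F G lam ![x₁, s]).Nodup}.Finite := by
  obtain ⟨d₁, hd₁, hsep₁⟩ := exists_ne_zero_forall_separable_map hF hFsq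
  obtain ⟨d₂, hd₂, hsep₂⟩ := exists_ne_zero_forall_separable_map hG hGsq
  obtain ⟨x, hx⟩ : ∃ x : Fin 2 → ℂ, eval x (X 0 * d₁ * d₂) ≠ 0 := by
    by_contra! h
    exact mul_ne_zero (mul_ne_zero (X_ne_zero 0) hd₁) hd₂
      (MvPolynomial.funext fun x ↦ by rw [h x, map_zero])
  simp only [map_mul, eval_X, mul_ne_zero_iff] at hx
  obtain ⟨⟨hx0, hx₁⟩, hx₂⟩ := hx
  have hn₁ := Polynomial.nodup_roots (hsep₁ (eval x) hx₁)
  have hn₂ := Polynomial.nodup_roots (hsep₂ (eval x) hx₂)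
  obtain ⟨lam, hlam⟩ := exists_injOn_sub_mul ⟨_, hn₁⟩ ⟨_, hn₂⟩
  obtain ⟨d, hd⟩ := exists_forall_nodup_iff hF hG (C lam)
  have hd' : ∀ y : Fin 2 → ℂ, eval y d ≠ 0 ↔ (rootCombinationValues F G lam y).Nodup := by
    intro y
    rw [hd (eval y), eval_C, rootCombinationValues]
  refine ⟨lam, x 0, hx0, ?_⟩
  let D : Polynomial ℂ := aeval ![Polynomial.C (x 0), Polynomial.X] d
  have hD : ∀ s, D.eval s = eval ![x 0, s] d := by
    intro s
    change Polynomial.eval s (aeval ![Polynomial.C (x 0), Polynomial.X] d) = _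
    rw [aeval_def, polynomial_eval_eval₂]
    congr 1
    · ext
      simp
    · funext i
      fin_cases i <;> simp
  have hD0 : D ≠ 0 := by
    intro h0
    have h1 : eval x d ≠ 0 := (hd' x).mpr
      (Multiset.Nodup.map_on (fun p hp q hq h ↦ hlam hp hq h) (hn₁.product hn₂))
    have h2 := hD (x 1)
    rw [h0, Polynomial.eval_zero, show ![x 0, x 1] = x by
      funext i
      fin_cases i <;> rfl] at h2
    exact h1 h2.symm
  refine (Polynomial.finite_setOfPred_isRoot hD0).subset fun s hs ↦ ?_
  rw [Set.mem_ofPred_eq, ← hd', not_not] at hs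
  exact (hD s).trans hs

/-- A general line avoids the finitely many points of the fibers over a finite set of `[x₁ : s]`
together with the point `[0 : 1]`. -/
lemma exists_linear_avoiding (V : (Fin 2 → ℂ) → Multiset ℂ) {x₁ : ℂ} (hx₁ : x₁ ≠ 0) {S : Set ℂ}
    (hS : S.Finite) : ∃ α β : ℂ, β ∉ V ![0, 1] ∧ ∀ s ∈ S, α * x₁ + β * s ∉ V ![x₁, s] := by
  obtain ⟨β, -, hβ⟩ := (Set.infinite_univ (α := ℂ)).exists_notMem_finite
    (V ![0, 1]).toFinset.finite_toSet
  obtain ⟨α, -, hα⟩ := (Set.infinite_univ (α := ℂ)).exists_notMem_finite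
    (hS.biUnion fun s _ ↦
      ((V ![x₁, s]).toFinset.image fun v ↦ (v - β * s) / x₁).finite_toSet)
  refine ⟨α, β, by simpa using hβ, fun s hs h ↦ hα ?_⟩
  simp only [Set.mem_iUnion]
  refine ⟨s, hs, ?_⟩
  rw [Finset.mem_coe, Finset.mem_image]
  exact ⟨_, Multiset.mem_toFinset.mpr h, by field_simp; ring⟩

/-- There is a (general) surface `X_∞ = {f_∞ = 0}` of degree `m + n`
such that (i) the projection `π₀ : [v] ↦ [v₁:v₂]` is injective on `Γ ∩ X_∞`, and
(ii) no point of `Γ ∩ X_∞` lies in a special fiber of `π₀|Γ`, i.e. in a fiber with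
fewer than `mn` points. -/
theorem general_Xinf_avoids_special_fibers
    (m n : ℕ) (hm : 1 ≤ m) (hn : 1 ≤ n)
    (f₁ f₂ : MvPolynomial (Fin 3) ℂ)
    (hsf₁ : Squarefree f₁) (hsf₂ : Squarefree f₂)
    (hf₁hom : f₁.IsHomogeneous m) (hf₂hom : f₂.IsHomogeneous n)
    (hf₁v : eval ![0, 0, 1] f₁ ≠ 0) (hf₂v : eval ![0, 0, 1] f₂ ≠ 0) :
    ∃ finf : MvPolynomial (Fin 4) ℂ, finf ≠ 0 ∧ finf.IsHomogeneous (m + n) ∧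
      -- (i) π₀ is injective on Γ ∩ {f_∞ = 0}
      (∀ v w : Fin 4 → ℂ, v ≠ 0 → w ≠ 0 →
        eval ![v 0, v 1, v 2] f₁ = 0 → eval ![v 0, v 1, v 3] f₂ = 0 → eval v finf = 0 →
        eval ![w 0, w 1, w 2] f₁ = 0 → eval ![w 0, w 1, w 3] f₂ = 0 → eval w finf = 0 →
        (∃ c : ℂ, c ≠ 0 ∧ w 0 = c * v 0 ∧ w 1 = c * v 1) →
        (∃ c : ℂ, c ≠ 0 ∧ w = c • v)) ∧
      -- (ii) no point of Γ ∩ {f_∞ = 0} lies in a fiber of π₀|Γ with fewer than mn points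
      (∀ v : Fin 4 → ℂ, v ≠ 0 →
        eval ![v 0, v 1, v 2] f₁ = 0 → eval ![v 0, v 1, v 3] f₂ = 0 → eval v finf = 0 →
        ¬ (gammaFiber f₁ f₂ (v 0) (v 1)).ncard < m * n) := by
  obtain ⟨F, hF, hFm, hFsq, hFf⟩ := exists_monic_of_isHomogeneous hsf₁ hf₁hom hf₁v
  obtain ⟨G, hG, hGn, hGsq, hGf⟩ := exists_monic_of_isHomogeneous hsf₂ hf₂hom hf₂v
  obtain ⟨lam, x₁, hx₁, hfin⟩ := exists_finite_setOf_not_nodup hF hG hFsq hGsq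
  obtain ⟨α, β, hβ, hα⟩ :=
    exists_linear_avoiding (rootCombinationValues F G lam) hx₁ hfin
  let L : MvPolynomial (Fin 4) ℂ := X 3 - C lam * X 2 - C α * X 0 - C β * X 1
  have hL : ∀ v, eval v L = v 3 - lam * v 2 - α * v 0 - β * v 1 := fun v ↦ by simp [L]
  have hLhom : L.IsHomogeneous 1 :=
    (((isHomogeneous_X _ _).sub (isHomogeneous_C_mul_X _ _)).sub
      (isHomogeneous_C_mul_X _ _)).sub (isHomogeneous_C_mul_X _ _)
  have hL0 : L ≠ 0 := by
    intro h
    have := hL ![0, 0, 0, 1]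
    simp [h] at this
  have hpow : ∀ v, eval v (L ^ (m + n)) = 0 → v 3 = lam * v 2 + α * v 0 + β * v 1 := by
    intro v hv
    rw [map_pow] at hv
    linear_combination (hL v).symm.trans (pow_eq_zero_iff (by lia) |>.mp hv)
  have key : ∀ v : Fin 4 → ℂ, v ≠ 0 → eval ![v 0, v 1, v 2] f₁ = 0 →
      eval ![v 0, v 1, v 3] f₂ = 0 → eval v (L ^ (m + n)) = 0 →
      ∃ c s a b : ℂ, c ≠ 0 ∧ v = c • ![x₁, s, a, b] ∧
        (rootCombinationValues F G lam ![x₁, s]).Nodup ∧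
        (a, b) ∈ (F.map (eval ![x₁, s])).roots ×ˢ (G.map (eval ![x₁, s])).roots ∧
        b - lam * a = α * x₁ + β * s := by
    intro v hv h1 h2 h3
    replace h3 := hpow v h3
    have scale : ∀ (c y₁ y₂ : ℂ), c ≠ 0 → v 0 = c * y₁ → v 1 = c * y₂ →
        (F.map (eval ![y₁, y₂])).eval (c⁻¹ * v 2) = 0 ∧
        (G.map (eval ![y₁, y₂])).eval (c⁻¹ * v 3) = 0 := by
      intro c y₁ y₂ hc e0 e1
      rw [hFf, hGf]
      refine ⟨(eval_eq_zero_iff_of_eq_smul hf₁hom hc ?_).mp h1,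
        (eval_eq_zero_iff_of_eq_smul hf₂hom hc ?_).mp h2⟩ <;>
      · funext i
        fin_cases i
        exacts [e0, e1, (mul_inv_cancel_left₀ hc _).symm]
    have hv0 : v 0 ≠ 0 := by
      intro h0
      by_cases h10 : v 1 = 0
      · have root_zero : ∀ {k : ℕ} {f : MvPolynomial (Fin 3) ℂ}, f.IsHomogeneous k →
            eval ![0, 0, 1] f ≠ 0 → ∀ z, eval ![0, 0, z] f = 0 → z = 0 := by
          intro k f hom hf z hz
          by_contra hz0
          exact hf ((eval_eq_zero_iff_of_eq_smul hom hz0 (by simp)).mp hz)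
        rw [h0, h10] at h1 h2
        apply hv
        funext i
        fin_cases i
        exacts [h0, h10, root_zero hf₁hom hf₁v _ h1, root_zero hf₂hom hf₂v _ h2]
      · obtain ⟨ha, hb⟩ := scale (v 1) 0 1 h10 (by simp [h0]) (by simp)
        apply hβ
        convert! mem_rootCombinationValues hF hG lam _ ha hb using 1
        rw [h3, h0]
        field_simp
        ring
    have hc : v 0 / x₁ ≠ 0 := div_ne_zero hv0 hx₁
    obtain ⟨ha, hb⟩ := scale (v 0 / x₁) x₁ ((v 0 / x₁)⁻¹ * v 1) hc
      (div_mul_cancel₀ _ hx₁).symm (mul_inv_cancel_left₀ hc _).symm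
    have hval : (v 0 / x₁)⁻¹ * v 3 - lam * ((v 0 / x₁)⁻¹ * v 2) =
        α * x₁ + β * ((v 0 / x₁)⁻¹ * v 1) := by
      rw [h3]
      field_simp
      ring
    refine ⟨v 0 / x₁, (v 0 / x₁)⁻¹ * v 1, (v 0 / x₁)⁻¹ * v 2, (v 0 / x₁)⁻¹ * v 3, hc, ?_, ?_,
      Multiset.mem_product.mpr ⟨(Polynomial.mem_roots (hF.map _).ne_zero).mpr ha,
        (Polynomial.mem_roots (hG.map _).ne_zero).mpr hb⟩, hval⟩
    · funext i
      fin_cases i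
      exacts [(div_mul_cancel₀ _ hx₁).symm, (mul_inv_cancel_left₀ hc _).symm,
        (mul_inv_cancel_left₀ hc _).symm, (mul_inv_cancel_left₀ hc _).symm]
    · by_contra hns
      exact hα _ hns (hval ▸ mem_rootCombinationValues hF hG lam _ ha hb)
  refine ⟨L ^ (m + n), pow_ne_zero _ hL0, by simpa using hLhom.pow (m + n), ?_, ?_⟩
  · intro v w hv hw hv1 hv2 hv3 hw1 hw2 hw3 ⟨k, hk, hk0, hk1⟩
    obtain ⟨c, s, a, b, hc, rfl, hnd, hab, hval⟩ := key v hv hv1 hv2 hv3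
    obtain ⟨c', s', a', b', hc', rfl, -, hab', hval'⟩ := key w hw hw1 hw2 hw3
    have e0 : c' * x₁ = k * (c * x₁) := hk0
    have e1 : c' * s' = k * (c * s) := hk1
    obtain rfl : c' = k * c := mul_right_cancel₀ hx₁ (by rw [e0, mul_assoc])
    obtain rfl : s' = s := mul_left_cancel₀ hc' (by rw [e1, mul_assoc])
    obtain ⟨rfl, rfl⟩ : a = a' ∧ b = b' := Prod.mk.inj
      (Multiset.inj_on_of_nodup_map hnd _ hab _ hab' (hval.trans hval'.symm))
    exact ⟨k, hk, (smul_smul _ _ _).symm⟩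
  · intro v hv hv1 hv2 hv3
    obtain ⟨c, s, a, b, hc, rfl, hnd, -, -⟩ := key v hv hv1 hv2 hv3
    have h := ncard_gammaFiber hf₁hom hf₂hom (hF.map (eval ![x₁, s])) (hG.map (eval ![x₁, s]))
      ((hF.natDegree_map _).trans hFm) ((hG.natDegree_map _).trans hGn) hx₁
      (fun z ↦ hFf ![x₁, s] z) (fun z ↦ hGf ![x₁, s] z) hnd.of_map hc
    exact not_lt.mpr h.ge
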